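/- arXiv:1705.03914 — 3 statements merged into one kernel-verified Lean document; each statement's English description precedes it below -/
import Mathlib

section
/- Let f be analytic on the disk of radius R with f(0) ≠ 0, and let 0 < r < R. Then exp(∫₀^1 log |f(r e^{2πiθ})| dθ) = |f(0)| · ∏_{z ∈ Z(f), 0<|z|<R} max{r/|z|, 1}, where the product is over the zeros of f counted with multiplicity (Jensen's formula in multiplicative form). -/
open MeasureTheory Real Complex

/-- A circle average is the mean over the parametrization of the circle by `[0, 1]`. -/
lemma circleAverage_zero_eq_integral_unitInterval (u : ℂ → ℝ) (r : ℝ) :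
    circleAverage u 0 r =
      ∫ θ in (0:ℝ)..1, u ((r : ℂ) * Complex.exp (2 * Real.pi * Complex.I * θ)) := by
  have h := intervalIntegral.integral_comp_mul_left (a := 0) (b := 1)
    (fun θ : ℝ ↦ u (circleMap 0 r θ)) Real.two_pi_pos.ne'
  rw [mul_zero, mul_one] at h
  rw [circleAverage, ← h]
  refine intervalIntegral.integral_congr fun θ _ ↦ ?_
  simp only [circleMap, zero_add]
  congr 3
  push_cast
  ring

/-- Jensen's formula in multiplicative form: if `f` is analytic on the disk of radius `R`
with `f 0 ≠ 0`, and `m z` records the multiplicity of each zero `z` of `f` in the disk,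
then for `0 < r < R`, the exponential of the logarithmic mean of `|f|` on the circle of
radius `r` equals `|f 0|` times the product over zeros `z` with `0 < |z| < R` of
`max (r/|z|) 1` to the power of the multiplicity. -/
theorem stmt1 (R r : ℝ) (hr : 0 < r) (hrR : r < R) (f : ℂ → ℂ)
    (hf : AnalyticOnNhd ℂ f (Metric.ball 0 R)) (hf0 : f 0 ≠ 0)
    (m : ℂ → ℕ)
    (hm : ∀ z ∈ Metric.ball (0 : ℂ) R, ∃ g : ℂ → ℂ, AnalyticAt ℂ g z ∧ g z ≠ 0 ∧
      ∀ᶠ w in nhds z, f w = (w - z) ^ (m z) * g w) :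
    Real.exp (∫ θ in (0:ℝ)..1,
        Real.log ‖f ((r : ℂ) * Complex.exp (2 * Real.pi * Complex.I * θ))‖)
      = ‖f 0‖ * ∏ᶠ z ∈ {z : ℂ | 0 < ‖z‖ ∧ ‖z‖ < R}, max (r / ‖z‖) 1 ^ (m z) := by
  have hsub : Metric.closedBall (0 : ℂ) |r| ⊆ Metric.ball 0 R := by
    rw [abs_of_pos hr]
    exact Metric.closedBall_subset_ball hrR
  have hfr : AnalyticOnNhd ℂ f (Metric.closedBall 0 |r|) := hf.mono hsub
  set D := MeromorphicOn.divisor f (Metric.closedBall 0 |r|) with hD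
  have hDm : ∀ z ∈ Metric.closedBall (0 : ℂ) |r|, D z = m z := by
    intro z hz
    obtain ⟨g, hg, hgz, hfg⟩ := hm z (hsub hz)
    have hord : analyticOrderAt f z = m z :=
      (hfr z hz).analyticOrderAt_eq_natCast.mpr ⟨g, hg, hgz, by simpa using hfg⟩
    rw [hD, MeromorphicOn.AnalyticOnNhd.divisor_apply hfr hz, hord]
    simp
  have hD0 : D 0 = 0 := by
    rw [hD, MeromorphicOn.AnalyticOnNhd.divisor_apply hfr (by simp),
      (hfr 0 (by simp)).analyticOrderAt_eq_zero.mpr hf0]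
    simp
  have hfin : (Function.support D).Finite := D.finiteSupport (isCompact_closedBall 0 |r|)
  have hmem : ∀ z, D z ≠ 0 → z ∈ Metric.closedBall (0 : ℂ) |r| := fun z hz ↦
    D.supportWithinDomain hz
  rw [← circleAverage_zero_eq_integral_unitInterval (fun z ↦ Real.log ‖f z‖),
    hfr.circleAverage_log_norm hr.ne' hf0, Real.exp_add, Real.exp_log (norm_pos_iff.mpr hf0),
    mul_comm]
  congr 1
  rw [finsum_eq_sum_of_support_subset (s := hfin.toFinset) _ fun z hz ↦ by
      rw [hfin.coe_toFinset]
      intro h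
      simp only [← hD, h, Int.cast_zero, zero_mul, Function.mem_support, ne_eq,
        not_true_eq_false] at hz,
    finprod_mem_def, finprod_eq_prod_of_mulSupport_subset (s := hfin.toFinset), Real.exp_sum]
  · refine Finset.prod_congr rfl fun z hz ↦ ?_
    have hz' : D z ≠ 0 := by simpa using hz
    have hzr := hmem z hz'
    have hz0 : 0 < ‖z‖ := norm_pos_iff.mpr fun h ↦ hz' (h ▸ hD0)
    have hzle : ‖z‖ ≤ r := by simpa [abs_of_pos hr] using hzr
    have hzA : z ∈ {z : ℂ | 0 < ‖z‖ ∧ ‖z‖ < R} := ⟨hz0, hzle.trans_lt hrR⟩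
    rw [Set.mulIndicator_of_mem hzA, max_eq_left ((one_le_div hz0).mpr hzle), ← hD, hDm z hzr,
      zero_sub, norm_neg, ← div_eq_mul_inv, Int.cast_natCast, Real.exp_nat_mul,
      Real.exp_log (div_pos hr hz0)]
  · intro z hz
    rw [hfin.coe_toFinset]
    rw [Function.mem_mulSupport] at hz
    intro hz'
    have hzA : z ∈ {z : ℂ | 0 < ‖z‖ ∧ ‖z‖ < R} := by
      by_contra h
      exact hz (Set.mulIndicator_of_notMem h _)
    rw [Set.mulIndicator_of_mem hzA] at hz
    rcases le_or_gt ‖z‖ r with h | h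
    · have hmz := hDm z (by simpa [abs_of_pos hr] using h)
      rw [hz'] at hmz
      exact hz (by rw [Nat.cast_eq_zero.mp hmz.symm, pow_zero])
    · exact hz (by rw [max_eq_right ((div_le_one hzA.1).mpr h.le), one_pow])
end

section
/- Let ζ be a standard complex Gaussian, N a positive integer, α ∈ ℂ, and 0 < β < 2/N. Then E[|ζ^N − α|^{-β}] ≤ Γ(1 − βN/2). -/
open MeasureTheory Real Complex

/-- The law of a standard complex Gaussian random variable: the measure on `ℂ` with
density `z ↦ e^{-|z|²}/π` with respect to Lebesgue measure. -/
noncomputable def stdComplexGaussian : Measure ℂ :=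
  volume.withDensity (fun z => ENNReal.ofReal (Real.exp (-‖z‖ ^ 2) / Real.pi))

section PolarCoordinates

open Set ENNReal

local instance fact_zero_lt_two_pi : Fact (0 < 2 * π) := ⟨two_pi_pos⟩

/-- Integration in polar coordinates on `ℂ`, the angle ranging over the additive circle. -/
theorem lintegral_complex_eq_lintegral_addCircle {F : ℂ → ℝ≥0∞} (hF : Measurable F) :
    ∫⁻ z, F z = ∫⁻ r in Ioi (0 : ℝ), ENNReal.ofReal r *
      ∫⁻ x : AddCircle (2 * π), F (r * (AddCircle.toCircle x : ℂ)) := by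
  have hmeas : Measurable fun p : ℝ × ℝ =>
      ENNReal.ofReal p.1 * F (Complex.polarCoord.symm p) := by
    simp only [Complex.polarCoord_symm_apply]
    fun_prop
  rw [← Complex.lintegral_comp_polarCoord_symm, polarCoord_target, Measure.volume_eq_prod]
  simp only [smul_eq_mul]
  rw [setLIntegral_prod _ hmeas.aemeasurable]
  refine lintegral_congr fun r => ?_
  rw [lintegral_const_mul' _ _ ofReal_ne_top, ← AddCircle.lintegral_preimage (2 * π) (-π),
    show -π + 2 * π = π by ring, restrict_Ioo_eq_restrict_Ioc]
  congr 1
  refine lintegral_congr fun θ => ?_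
  rw [Complex.polarCoord_symm_apply, AddCircle.toCircle_apply_mk,
    div_self two_pi_pos.ne', one_mul, Circle.coe_exp, exp_mul_I]
  push_cast
  rfl

/-- The image of Lebesgue measure on `ℂ` under `z ↦ z ^ N` has density `‖w‖ ^ (2 / N - 2) / N`. -/
theorem lintegral_comp_pow {N : ℕ} (hN : 0 < N) {F : ℂ → ℝ≥0∞} (hF : Measurable F) :
    ∫⁻ z : ℂ, F (z ^ N) = ∫⁻ w, ENNReal.ofReal (‖w‖ ^ (2 / N - 2 : ℝ) / N) * F w := by
  have hN' : (0 : ℝ) < N := by exact_mod_cast hN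
  have himage : (fun r : ℝ => r ^ N) '' Ioi 0 = Ioi 0 := by
    ext r
    constructor
    · rintro ⟨x, hx, rfl⟩
      exact pow_pos (mem_Ioi.1 hx) N
    · intro hr
      exact ⟨r ^ (N⁻¹ : ℝ), rpow_pos_of_pos hr _, rpow_inv_natCast_pow (le_of_lt hr) hN.ne'⟩
  have hangle (ρ : ℝ) : ∫⁻ x : AddCircle (2 * π), F (ρ * (AddCircle.toCircle x : ℂ) ^ N) =
      ∫⁻ x : AddCircle (2 * π), F (ρ * (AddCircle.toCircle x : ℂ)) := by
    have hpres : MeasurePreserving (fun x : AddCircle (2 * π) => (N : ℤ) • x) volume volume :=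
      Measure.measurePreserving_zsmul volume (by exact_mod_cast hN.ne')
    have hcirc : Measurable fun x : AddCircle (2 * π) => F (ρ * (AddCircle.toCircle x : ℂ)) :=
      hF.comp (continuous_const.mul
        (continuous_subtype_val.comp AddCircle.continuous_toCircle)).measurable
    rw [← hpres.lintegral_comp hcirc]
    simp [AddCircle.toCircle_nsmul]
  rw [lintegral_complex_eq_lintegral_addCircle (by fun_prop),
    lintegral_complex_eq_lintegral_addCircle (by fun_prop)]
  conv_rhs => rw [← himage]
  rw [lintegral_image_eq_lintegral_abs_deriv_mul measurableSet_Ioi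
      (fun x _ => (hasDerivAt_pow N x).hasDerivWithinAt)
      ((pow_left_strictMonoOn₀ hN.ne').injOn.mono fun x hx => le_of_lt hx)]
  refine setLIntegral_congr_fun measurableSet_Ioi fun r hr => ?_
  have hr0 : 0 < r := hr
  have hpow : (r ^ N) ^ (2 / N - 2 : ℝ) * r ^ N * r ^ N = r ^ 2 := by
    rw [← rpow_natCast r N, ← rpow_mul hr0.le, ← rpow_add hr0, ← rpow_add hr0, ← rpow_natCast r 2]
    congr 1
    push_cast
    field_simp
    ring
  have hjac : r = |N * r ^ (N - 1)| * (r ^ N * ((r ^ N) ^ (2 / N - 2 : ℝ) / N)) := by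
    have hsucc : r ^ (N - 1) * r = r ^ N := pow_sub_one_mul hN.ne' r
    rw [abs_of_nonneg (by positivity)]
    refine mul_right_cancel₀ hr0.ne' ?_
    calc r * r = (r ^ N) ^ (2 / N - 2 : ℝ) * r ^ N * r ^ N := by rw [hpow]; ring
      _ = (r ^ N) ^ (2 / N - 2 : ℝ) * r ^ N * (r ^ (N - 1) * r) := by rw [hsucc]
      _ = _ := by field_simp
  simp only [mul_pow, norm_mul, Circle.norm_coe, mul_one, Complex.norm_real,
    Real.norm_of_nonneg (pow_nonneg hr0.le N)]
  rw [lintegral_const_mul' _ _ ofReal_ne_top, ← Complex.ofReal_pow, hangle, ← mul_assoc, ← mul_assoc,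
    ← ENNReal.ofReal_mul (by positivity), ← ENNReal.ofReal_mul (by positivity), mul_assoc,
    ← hjac]

end PolarCoordinates

/-- Bathtub principle: `∫⁻ g` over `A` is at most `∫⁻ g` over `B` if `A` has no larger measure and
`B` is a superlevel set of `g` at level `c`. -/
theorem setLIntegral_le_of_measure_le {X : Type*} [MeasurableSpace X] {μ : Measure X}
    {A B : Set X} (hA : MeasurableSet A) (hB : MeasurableSet B) (hAB : μ A ≤ μ B)
    (hAfin : μ A ≠ ⊤) {g : X → ENNReal} (c : ENNReal)
    (hgA : ∀ x ∈ A \ B, g x ≤ c) (hgB : ∀ x ∈ B \ A, c ≤ g x) :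
    ∫⁻ x in A, g x ∂μ ≤ ∫⁻ x in B, g x ∂μ := by
  have hdiff : μ (A \ B) ≤ μ (B \ A) := by
    rw [← measure_inter_add_sdiff A hB, ← measure_inter_add_sdiff B hA, Set.inter_comm B A] at hAB
    exact (ENNReal.add_le_add_iff_left
      (measure_ne_top_of_subset Set.inter_subset_left hAfin)).1 hAB
  rw [← lintegral_inter_add_sdiff g A hB, ← lintegral_inter_add_sdiff g B hA, Set.inter_comm B A]
  gcongr 1
  calc ∫⁻ x in A \ B, g x ∂μ ≤ ∫⁻ _ in A \ B, c ∂μ := setLIntegral_mono' (hA.diff hB) hgA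
    _ = c * μ (A \ B) := setLIntegral_const _ _
    _ ≤ c * μ (B \ A) := by gcongr
    _ = ∫⁻ _ in B \ A, c ∂μ := (setLIntegral_const _ _).symm
    _ ≤ ∫⁻ x in B \ A, g x ∂μ := setLIntegral_mono' (hB.diff hA) hgB

/-- The density, as a function of the modulus, of `ζ ^ N` for `ζ` a standard complex Gaussian. -/
noncomputable def gaussianPowDensity (N : ℕ) (r : ℝ) : ℝ :=
  r ^ (2 / N - 2 : ℝ) / N * (Real.exp (-r ^ (2 / N : ℝ)) / π)

theorem gaussianPowDensity_le {N : ℕ} (hN : 0 < N) {r s : ℝ} (hr : 0 < r) (hrs : r ≤ s) :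
    gaussianPowDensity N s ≤ gaussianPowDensity N r := by
  have hN' : (1 : ℝ) ≤ N := by exact_mod_cast hN
  have hexp : (2 / N - 2 : ℝ) ≤ 0 := by
    rw [sub_nonpos]
    exact div_le_self zero_le_two hN'
  have hs : 0 < s := hr.trans_le hrs
  have h1 : s ^ (2 / N - 2 : ℝ) ≤ r ^ (2 / N - 2 : ℝ) :=
    rpow_le_rpow_of_nonpos hr hrs hexp
  unfold gaussianPowDensity
  gcongr

theorem stdComplexGaussian_preimage_pow {N : ℕ} (hN : 0 < N) {A : Set ℂ} (hA : MeasurableSet A) :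
    stdComplexGaussian {z | z ^ N ∈ A} =
      ∫⁻ w in A, ENNReal.ofReal (gaussianPowDensity N ‖w‖) := by
  have hN' : (N : ℝ) ≠ 0 := by exact_mod_cast hN.ne'
  have hpre : MeasurableSet {z : ℂ | z ^ N ∈ A} := (by fun_prop : Measurable fun z : ℂ => z ^ N) hA
  have hF : Measurable (A.indicator fun w : ℂ =>
      ENNReal.ofReal (Real.exp (-‖w‖ ^ (2 / N : ℝ)) / π)) :=
    Measurable.indicator (by fun_prop) hA
  rw [stdComplexGaussian, withDensity_apply _ hpre, ← lintegral_indicator hpre,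
    ← lintegral_indicator hA]
  trans ∫⁻ z : ℂ, A.indicator (fun w : ℂ =>
      ENNReal.ofReal (Real.exp (-‖w‖ ^ (2 / N : ℝ)) / π)) (z ^ N)
  · refine lintegral_congr fun z => ?_
    by_cases hz : z ^ N ∈ A
    · rw [Set.indicator_of_mem hz, Set.indicator_of_mem (by exact hz), norm_pow,
        ← rpow_natCast ‖z‖ N, ← rpow_mul (norm_nonneg z), mul_div_cancel₀ _ hN', rpow_two]
    · rw [Set.indicator_of_notMem hz, Set.indicator_of_notMem (by exact hz)]
  · rw [lintegral_comp_pow hN hF]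
    refine lintegral_congr fun w => ?_
    by_cases hw : w ∈ A
    · simp only [hw, Set.indicator_of_mem, gaussianPowDensity]
      rw [ENNReal.ofReal_mul (by positivity)]
    · simp [hw]

/-- `‖ζ ^ N‖` is stochastically dominated by `‖ζ ^ N - α‖`. -/
theorem stdComplexGaussian_pow_mem_closedBall_le {N : ℕ} (hN : 0 < N) (α : ℂ) {s : ℝ}
    (hs : 0 < s) :
    stdComplexGaussian {z | z ^ N ∈ Metric.closedBall α s} ≤
      stdComplexGaussian {z | z ^ N ∈ Metric.closedBall 0 s \ {0}} := by
  have hB : MeasurableSet (Metric.closedBall (0 : ℂ) s \ {0}) :=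
    measurableSet_closedBall.diff (measurableSet_singleton 0)
  rw [stdComplexGaussian_preimage_pow hN measurableSet_closedBall,
    stdComplexGaussian_preimage_pow hN hB]
  rw [← setLIntegral_congr (sdiff_null_ae_eq_self (measure_singleton (0 : ℂ)))]
  have hα : volume (Metric.closedBall α s \ {0}) = volume (Metric.closedBall α s) :=
    measure_sdiff_null (measure_singleton 0)
  refine setLIntegral_le_of_measure_le (measurableSet_closedBall.diff (measurableSet_singleton 0))
    hB ?_ (hα ▸ measure_closedBall_lt_top.ne) (ENNReal.ofReal (gaussianPowDensity N s)) ?_ ?_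
  · rw [hα, measure_sdiff_null (measure_singleton 0), Measure.addHaar_closedBall_center]
  · rintro w ⟨⟨-, hw0⟩, hw⟩
    refine ENNReal.ofReal_le_ofReal (gaussianPowDensity_le hN hs ?_)
    by_contra! hlt
    exact hw ⟨by simpa using hlt.le, hw0⟩
  · rintro w ⟨⟨hw, hw0⟩, -⟩
    exact ENNReal.ofReal_le_ofReal
      (gaussianPowDensity_le hN (norm_pos_iff.2 hw0) (by simpa using hw))

theorem lintegral_norm_pow_sub_rpow_le {N : ℕ} (hN : 0 < N) (α : ℂ) {β : ℝ} (hβ : 0 < β) :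
    ∫⁻ z, ENNReal.ofReal (‖z ^ N - α‖ ^ (-β)) ∂stdComplexGaussian ≤
      ∫⁻ z, ENNReal.ofReal (‖z ^ N‖ ^ (-β)) ∂stdComplexGaussian := by
  rw [lintegral_eq_lintegral_meas_le _ (ae_of_all _ fun z => by positivity) (by fun_prop),
    lintegral_eq_lintegral_meas_le _ (ae_of_all _ fun z => by positivity) (by fun_prop)]
  refine setLIntegral_mono' measurableSet_Ioi fun t ht => ?_
  have ht0 : 0 < t := ht
  have hs : 0 < t ^ (-β)⁻¹ := rpow_pos_of_pos ht0 _
  refine (measure_mono fun z hz => ?_).trans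
    ((stdComplexGaussian_pow_mem_closedBall_le hN α hs).trans (measure_mono fun z hz => ?_))
  · rw [Set.mem_ofPred_eq] at hz
    rw [Set.mem_ofPred_eq, mem_closedBall_iff_norm]
    rcases (norm_nonneg (z ^ N - α)).eq_or_lt with h0 | h0
    · rw [← h0]
      exact hs.le
    · exact (le_rpow_inv_iff_of_neg h0 ht0 (neg_lt_zero.2 hβ)).2 hz
  · obtain ⟨hz, hz0⟩ := hz
    rw [mem_closedBall_zero_iff] at hz
    exact (le_rpow_inv_iff_of_neg (norm_pos_iff.2 hz0) ht0 (neg_lt_zero.2 hβ)).1 hz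

theorem lintegral_norm_pow_rpow {N : ℕ} (hN : 0 < N) {β : ℝ} (hβ : β < 2 / N) :
    ∫⁻ z, ENNReal.ofReal (‖z ^ N‖ ^ (-β)) ∂stdComplexGaussian =
      ENNReal.ofReal (Real.Gamma (1 - β * N / 2)) := by
  have hN' : (0 : ℝ) < N := by exact_mod_cast hN
  have hlt : β * N < 2 := (lt_div_iff₀ hN').1 hβ
  have hΓ : 0 < Real.Gamma (1 - β * N / 2) := Real.Gamma_pos_of_pos (by linarith)
  have hint : ∫ z : ℂ, ‖z‖ ^ (-(β * N)) * Real.exp (-‖z‖ ^ (2 : ℝ)) =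
      π * Real.Gamma (1 - β * N / 2) := by
    rw [Complex.integral_rpow_mul_exp_neg_rpow one_le_two (by linarith),
      mul_div_cancel_left₀ _ two_ne_zero]
    congr 2
    ring
  have hintble : Integrable fun z : ℂ => ‖z‖ ^ (-(β * N)) * Real.exp (-‖z‖ ^ (2 : ℝ)) :=
    Integrable.of_integral_ne_zero (by rw [hint]; positivity)
  have hdens : ∀ z : ℂ, ENNReal.ofReal (Real.exp (-‖z‖ ^ 2) / π) *
      ENNReal.ofReal (‖z ^ N‖ ^ (-β)) =
      ENNReal.ofReal ((‖z‖ ^ (-(β * N)) * Real.exp (-‖z‖ ^ (2 : ℝ))) / π) := fun z => by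
    rw [← ENNReal.ofReal_mul (by positivity), norm_pow, ← rpow_natCast ‖z‖ N,
      ← rpow_mul (norm_nonneg z), rpow_two, mul_neg, mul_comm (N : ℝ) β]
    congr 1
    ring
  rw [stdComplexGaussian, lintegral_withDensity_eq_lintegral_mul _ (by fun_prop) (by fun_prop)]
  simp only [Pi.mul_apply, hdens]
  rw [← ofReal_integral_eq_lintegral_ofReal (hintble.div_const π)
    (ae_of_all _ fun z => by positivity), integral_div, hint, mul_div_cancel_left₀ _ pi_ne_zero]

/-- If `ζ` is a standard complex Gaussian, `N ≥ 1`, `α ∈ ℂ`, and `0 < β < 2/N`, then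
`E[|ζ^N − α|^{-β}] ≤ Γ(1 − βN/2)`. -/
theorem stmt5 (N : ℕ) (hN : 0 < N) (α : ℂ) (β : ℝ) (hβ : 0 < β) (hβ' : β < 2 / N) :
    ∫ z : ℂ, ‖z ^ N - α‖ ^ (-β) ∂stdComplexGaussian ≤ Real.Gamma (1 - β * N / 2) := by
  have hN' : (0 : ℝ) < N := by exact_mod_cast hN
  have hlt : β * N < 2 := (lt_div_iff₀ hN').1 hβ'
  rw [integral_eq_lintegral_of_nonneg_ae (ae_of_all _ fun z => by positivity)
    (by fun_prop : Measurable fun z : ℂ => ‖z ^ N - α‖ ^ (-β)).aestronglyMeasurable]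
  refine ENNReal.toReal_le_of_le_ofReal (Real.Gamma_pos_of_pos (by linarith)).le ?_
  exact (lintegral_norm_pow_sub_rpow_le hN α hβ).trans_eq (lintegral_norm_pow_rpow hN hβ')
end

section
/- Let (X, Y) be jointly complex Gaussian, with X and Y each standard complex Gaussian (not necessarily independent). Then E[|X| · |Y|^{-1}] ≤ E[|X|] · E[|Y|^{-1}] = √π. -/
open MeasureTheory Real Complex ProbabilityTheory

/-- Binary rearrangement inequality in `ℝ≥0∞`. -/
lemma mul_add_mul_le_of_le {a b c d : ENNReal} (hab : a ≤ b) (hcd : c ≤ d) :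
    a * d + b * c ≤ a * c + b * d := by
  obtain ⟨e, rfl⟩ := exists_add_of_le hcd
  rw [mul_add, mul_add, add_right_comm, ← add_assoc]
  gcongr

/-- **Chebyshev's integral inequality** for an antitone and a monotone function. -/
lemma lintegral_mul_mul_measure_univ_le {α : Type*} [MeasurableSpace α] [LinearOrder α]
    {m : Measure α} [SFinite m] {s : Set α} (hs : ∀ᵐ x ∂m, x ∈ s) {F H : α → ENNReal}
    (hF : Measurable F) (hH : Measurable H) (hFs : AntitoneOn F s) (hHs : MonotoneOn H s) :
    (∫⁻ x, F x * H x ∂m) * m Set.univ ≤ (∫⁻ x, F x ∂m) * ∫⁻ x, H x ∂m := by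
  have key : ∫⁻ x, ∫⁻ y, (F x * H x + F y * H y) ∂m ∂m
      ≤ ∫⁻ x, ∫⁻ y, (F x * H y + F y * H x) ∂m ∂m := by
    refine lintegral_mono_ae (hs.mono fun x hx => lintegral_mono_ae (hs.mono fun y hy => ?_))
    rcases le_total x y with h | h
    · rw [add_comm, add_comm (F x * H y)]
      exact mul_add_mul_le_of_le (hFs hx hy h) (hHs hx hy h)
    · exact mul_add_mul_le_of_le (hFs hy hx h) (hHs hy hx h)
  have hl : ∀ x, ∫⁻ y, (F x * H x + F y * H y) ∂m
      = F x * H x * m Set.univ + ∫⁻ y, F y * H y ∂m := fun x => by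
    rw [lintegral_add_left measurable_const, lintegral_const]
  have hr : ∀ x, ∫⁻ y, (F x * H y + F y * H x) ∂m
      = F x * ∫⁻ y, H y ∂m + (∫⁻ y, F y ∂m) * H x := fun x => by
    rw [lintegral_add_left (hH.const_mul _), lintegral_const_mul _ hH, lintegral_mul_const _ hF]
  simp_rw [hl, hr] at key
  rw [lintegral_add_left (by fun_prop), lintegral_add_left (hF.mul_const _),
    lintegral_mul_const _ (by fun_prop), lintegral_mul_const _ hF, lintegral_const_mul _ hH,
    lintegral_const, ← two_mul, ← two_mul] at key
  exact (ENNReal.mul_le_mul_iff_right (by simp) (by simp)).1 key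

lemma stdComplexGaussian_eq_map : stdComplexGaussian =
    ((gaussianReal 0 (1 / 2)).prod (gaussianReal 0 (1 / 2))).map
      Complex.measurableEquivRealProd.symm := by
  rw [gaussianReal_of_var_ne_zero _ (by norm_num),
    prod_withDensity (measurable_gaussianPDF _ _) (measurable_gaussianPDF _ _)]
  ext s hs
  rw [Measure.map_apply (by fun_prop) hs, stdComplexGaussian, withDensity_apply _ hs,
    withDensity_apply _ (by measurability), ← Measure.volume_eq_prod,
    ← Complex.volume_preserving_equiv_real_prod.symm.setLIntegral_comp_preimage hs (by fun_prop)]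
  refine lintegral_congr fun p => ?_
  rw [gaussianPDF, gaussianPDF, ← ENNReal.ofReal_mul (gaussianPDFReal_nonneg _ _ _)]
  congr 1
  have : ‖Complex.measurableEquivRealProd.symm p‖ ^ 2 = p.1 ^ 2 + p.2 ^ 2 := by
    rw [Complex.sq_norm, Complex.normSq_apply]
    simp [Complex.measurableEquivRealProd, sq]
  rw [this, gaussianPDFReal, gaussianPDFReal]
  have hpi : √(2 * π * ((1 / 2 : NNReal) : ℝ)) = √π := by congr 1; push_cast; ring
  rw [hpi, mul_mul_mul_comm, ← Real.exp_add, ← mul_inv, Real.mul_self_sqrt Real.pi_pos.le,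
    div_eq_inv_mul]
  congr 2
  push_cast
  ring

instance isProbabilityMeasure_stdComplexGaussian : IsProbabilityMeasure stdComplexGaussian := by
  rw [stdComplexGaussian_eq_map]
  exact Measure.isProbabilityMeasure_map (by fun_prop)

/-- The measure on `(0, ∞)` with density `r ↦ r e^{-r²}/π`: the law of the modulus of a standard
complex Gaussian, divided by `2π`. -/
noncomputable def stdComplexGaussianRadial : Measure ℝ :=
  (volume.restrict (Set.Ioi 0)).withDensity
    (fun r => ENNReal.ofReal r * ENNReal.ofReal (Real.exp (-r ^ 2) / Real.pi))

lemma lintegral_stdComplexGaussian {f : ℂ → ENNReal} (hf : Measurable f) :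
    ∫⁻ z, f z ∂stdComplexGaussian = ∫⁻ r, (∫⁻ θ in Set.Ioo (-Real.pi) Real.pi,
      f (Complex.polarCoord.symm (r, θ))) ∂stdComplexGaussianRadial := by
  have hsymm : Measurable fun p : ℝ × ℝ => f (Complex.polarCoord.symm p) := by
    simp only [Complex.polarCoord_symm_apply]
    fun_prop
  rw [stdComplexGaussian, stdComplexGaussianRadial,
    lintegral_withDensity_eq_lintegral_mul _ (by fun_prop) hf,
    lintegral_withDensity_eq_lintegral_mul _ (by fun_prop) hsymm.lintegral_prod_right',
    ← Complex.lintegral_comp_polarCoord_symm, polarCoord_target, Measure.volume_eq_prod,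
    ← Measure.prod_restrict, lintegral_prod]
  · refine setLIntegral_congr_fun measurableSet_Ioi fun r hr => ?_
    have hθ : Measurable fun θ => f (Complex.polarCoord.symm (r, θ)) :=
      hsymm.comp measurable_prodMk_left
    rw [Pi.mul_apply, ← lintegral_const_mul _ hθ]
    refine lintegral_congr fun θ => ?_
    rw [Pi.mul_apply, Complex.norm_polarCoord_symm, abs_of_pos hr, smul_eq_mul, mul_assoc]
  · simp only [Pi.mul_apply, Complex.norm_polarCoord_symm, smul_eq_mul]
    exact (Measurable.mul (by fun_prop) (Measurable.mul (by fun_prop) hsymm)).aemeasurable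

instance sFinite_stdComplexGaussianRadial : SFinite stdComplexGaussianRadial := by
  unfold stdComplexGaussianRadial; infer_instance

/-- Under the standard complex Gaussian, a function that increases along rays from the origin is
negatively correlated with any decreasing function of the modulus. -/
lemma lintegral_radial_mul_le
    {F : ℝ → ENNReal} {G : ℂ → ENNReal} (hF : Measurable F) (hG : Measurable G)
    (hFanti : AntitoneOn F (Set.Ioi 0))
    (hGmono : ∀ z : ℂ, ∀ r s : ℝ, 0 < r → r ≤ s → G (r * z) ≤ G (s * z)) :
    ∫⁻ z, G z * F ‖z‖ ∂stdComplexGaussian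
      ≤ (∫⁻ z, G z ∂stdComplexGaussian) * ∫⁻ z, F ‖z‖ ∂stdComplexGaussian := by
  set m := stdComplexGaussianRadial
  have hpos : ∀ᵐ r ∂m, r ∈ Set.Ioi (0 : ℝ) :=
    (withDensity_absolutelyContinuous _ _).ae_le (ae_restrict_mem measurableSet_Ioi)
  have hsymm : Measurable fun p : ℝ × ℝ => G (Complex.polarCoord.symm p) := by
    simp only [Complex.polarCoord_symm_apply]
    fun_prop
  set H : ℝ → ENNReal := fun r => ∫⁻ θ in Set.Ioo (-Real.pi) Real.pi,
    G (Complex.polarCoord.symm (r, θ)) with hH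
  have hHmeas : Measurable H := hsymm.lintegral_prod_right'
  have hHmono : MonotoneOn H (Set.Ioi 0) := by
    intro r hr s _ hrs
    refine lintegral_mono fun θ => ?_
    simp only [Complex.polarCoord_symm_apply]
    exact hGmono _ r s hr hrs
  set c : ENNReal := volume (Set.Ioo (-Real.pi) Real.pi) with hc
  have h1 : m Set.univ * c = 1 := by
    have := lintegral_stdComplexGaussian (f := fun _ => 1) measurable_const
    simp only [lintegral_const, measure_univ, one_mul, Measure.restrict_apply_univ] at this
    rw [mul_comm]
    exact this.symm
  have h2 : ∫⁻ z, F ‖z‖ ∂stdComplexGaussian = (∫⁻ r, F r ∂m) * c := by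
    rw [lintegral_stdComplexGaussian (by fun_prop), ← lintegral_mul_const _ hF]
    refine lintegral_congr_ae (hpos.mono fun r hr => ?_)
    simp only [Complex.norm_polarCoord_symm, abs_of_pos (Set.mem_Ioi.1 hr), lintegral_const,
      Measure.restrict_apply_univ, hc]
  have h3 : ∫⁻ z, G z * F ‖z‖ ∂stdComplexGaussian = ∫⁻ r, F r * H r ∂m := by
    rw [lintegral_stdComplexGaussian (by fun_prop)]
    refine lintegral_congr_ae (hpos.mono fun r hr => ?_)
    simp only [Complex.norm_polarCoord_symm, abs_of_pos (Set.mem_Ioi.1 hr), hH]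
    have hθ : Measurable fun θ => G (Complex.polarCoord.symm (r, θ)) :=
      hsymm.comp measurable_prodMk_left
    rw [lintegral_mul_const _ hθ, mul_comm]
  calc ∫⁻ z, G z * F ‖z‖ ∂stdComplexGaussian = (∫⁻ r, F r * H r ∂m) * (m Set.univ * c) := by
        rw [h1, mul_one, h3]
    _ = (∫⁻ r, F r * H r ∂m) * m Set.univ * c := (mul_assoc _ _ _).symm
    _ ≤ (∫⁻ r, F r ∂m) * (∫⁻ r, H r ∂m) * c := by
        exact mul_le_mul_left
          (lintegral_mul_mul_measure_univ_le hpos hF hHmeas hFanti hHmono) c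
    _ = _ := by
        rw [h2, lintegral_stdComplexGaussian hG]
        ring

section StdComplexGaussian

variable {Ω : Type*} [MeasurableSpace Ω] {P : Measure Ω} {Y : Ω → ℂ}

lemma map_prod_re_im (hY : Measurable Y) (h : P.map Y = stdComplexGaussian) :
    P.map (fun ω => ((Y ω).re, (Y ω).im)) =
      (gaussianReal 0 (1 / 2)).prod (gaussianReal 0 (1 / 2)) := by
  have : (fun ω => ((Y ω).re, (Y ω).im)) = Complex.measurableEquivRealProd ∘ Y := rfl
  rw [this, ← Measure.map_map (by fun_prop) hY, h, stdComplexGaussian_eq_map,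
    Measure.map_map (by fun_prop) (by fun_prop)]
  simp

lemma map_re (hY : Measurable Y) (h : P.map Y = stdComplexGaussian) :
    P.map (fun ω => (Y ω).re) = gaussianReal 0 (1 / 2) := by
  have := congrArg (Measure.map Prod.fst) (map_prod_re_im hY h)
  rwa [Measure.map_map (by fun_prop) (by fun_prop), Measure.map_fst_prod, measure_univ,
    one_smul] at this

lemma map_im (hY : Measurable Y) (h : P.map Y = stdComplexGaussian) :
    P.map (fun ω => (Y ω).im) = gaussianReal 0 (1 / 2) := by
  have := congrArg (Measure.map Prod.snd) (map_prod_re_im hY h)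
  rwa [Measure.map_map (by fun_prop) (by fun_prop), Measure.map_snd_prod, measure_univ,
    one_smul] at this


lemma hasLaw_re (hY : Measurable Y) (h : P.map Y = stdComplexGaussian) :
    HasLaw (fun ω => (Y ω).re) (gaussianReal 0 (1 / 2)) P :=
  ⟨by fun_prop, map_re hY h⟩

lemma hasLaw_im (hY : Measurable Y) (h : P.map Y = stdComplexGaussian) :
    HasLaw (fun ω => (Y ω).im) (gaussianReal 0 (1 / 2)) P :=
  ⟨by fun_prop, map_im hY h⟩

lemma memLp_re (hY : Measurable Y) (h : P.map Y = stdComplexGaussian) :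
    MemLp (fun ω => (Y ω).re) 2 P :=
  (hasLaw_re hY h).hasGaussianLaw.memLp_two

lemma memLp_im (hY : Measurable Y) (h : P.map Y = stdComplexGaussian) :
    MemLp (fun ω => (Y ω).im) 2 P :=
  (hasLaw_im hY h).hasGaussianLaw.memLp_two

lemma covariance_re_im [IsProbabilityMeasure P] (hY : Measurable Y)
    (h : P.map Y = stdComplexGaussian) :
    cov[fun ω => (Y ω).re, fun ω => (Y ω).im; P] = 0 := by
  refine IndepFun.covariance_eq_zero ?_ (memLp_re hY h) (memLp_im hY h)
  rw [indepFun_iff_map_prod_eq_prod_map_map (by fun_prop) (by fun_prop), map_prod_re_im hY h,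
    map_re hY h, map_im hY h]

lemma covariance_mul_add_mul_left [IsFiniteMeasure P] {U V W : Ω → ℝ} (hU : MemLp U 2 P)
    (hV : MemLp V 2 P) (hW : MemLp W 2 P) (a b : ℝ) :
    cov[fun ω => U ω * a + V ω * b, W; P] = cov[U, W; P] * a + cov[V, W; P] * b := by
  have := covariance_add_left (hU.mul_const a) (hV.mul_const b) hW
  rwa [covariance_mul_const_left, covariance_mul_const_left] at this

lemma covariance_mul_add_mul_right [IsFiniteMeasure P] {U V W : Ω → ℝ} (hU : MemLp U 2 P)
    (hV : MemLp V 2 P) (hW : MemLp W 2 P) (a b : ℝ) :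
    cov[W, fun ω => U ω * a + V ω * b; P] = cov[W, U; P] * a + cov[W, V; P] * b := by
  rw [covariance_comm, covariance_mul_add_mul_left hU hV hW, covariance_comm U, covariance_comm V]

lemma memLp_mul_add_mul {U V : Ω → ℝ} (hU : MemLp U 2 P) (hV : MemLp V 2 P) (a b : ℝ) :
    MemLp (fun ω => U ω * a + V ω * b) 2 P :=
  (hU.mul_const a).add (hV.mul_const b)

lemma covariance_residual_re [IsProbabilityMeasure P] (hY : Measurable Y)
    (h : P.map Y = stdComplexGaussian) {U : Ω → ℝ} (hU : MemLp U 2 P) (b : ℝ) :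
    cov[fun ω => U ω - ((Y ω).re * (2 * cov[U, fun ω => (Y ω).re; P]) + (Y ω).im * b),
      fun ω => (Y ω).re; P] = 0 := by
  have hre := memLp_re hY h
  have him := memLp_im hY h
  rw [covariance_fun_sub_left hU (memLp_mul_add_mul hre him _ _) hre,
    covariance_mul_add_mul_left hre him hre, covariance_comm (fun ω => (Y ω).im),
    covariance_re_im hY h, covariance_self (by fun_prop), (hasLaw_re hY h).variance_eq,
    variance_id_gaussianReal]
  push_cast
  ring

lemma covariance_residual_im [IsProbabilityMeasure P] (hY : Measurable Y)
    (h : P.map Y = stdComplexGaussian) {U : Ω → ℝ} (hU : MemLp U 2 P) (a : ℝ) :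
    cov[fun ω => U ω - ((Y ω).re * a + (Y ω).im * (2 * cov[U, fun ω => (Y ω).im; P])),
      fun ω => (Y ω).im; P] = 0 := by
  have hre := memLp_re hY h
  have him := memLp_im hY h
  rw [covariance_fun_sub_left hU (memLp_mul_add_mul hre him _ _) him,
    covariance_mul_add_mul_left hre him him,
    covariance_re_im hY h, covariance_self (by fun_prop), (hasLaw_im hY h).variance_eq,
    variance_id_gaussianReal]
  push_cast
  ring

/-- Gaussian regression: subtracting a suitable `ℝ`-linear function of `Y` from `X` leaves a residual
independent of `Y`. -/
lemma exists_indepFun_residual [IsProbabilityMeasure P] {X : Ω → ℂ}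
    (hY : Measurable Y) (h : P.map Y = stdComplexGaussian)
    (hXY : HasGaussianLaw (fun ω => (X ω, Y ω)) P) :
    ∃ A : ℂ →L[ℝ] ℂ, HasGaussianLaw (fun ω => X ω - A (Y ω)) P ∧
      IndepFun (fun ω => X ω - A (Y ω)) Y P := by
  have hXre : MemLp (fun ω => (X ω).re) 2 P := (hXY.fst.map_fun Complex.reCLM).memLp_two
  have hXim : MemLp (fun ω => (X ω).im) 2 P := (hXY.fst.map_fun Complex.imCLM).memLp_two
  have hre := memLp_re hY h
  have him := memLp_im hY h
  let c₁ : ℂ := ⟨2 * cov[fun ω => (X ω).re, fun ω => (Y ω).re; P],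
    2 * cov[fun ω => (X ω).im, fun ω => (Y ω).re; P]⟩
  let c₂ : ℂ := ⟨2 * cov[fun ω => (X ω).re, fun ω => (Y ω).im; P],
    2 * cov[fun ω => (X ω).im, fun ω => (Y ω).im; P]⟩
  let A : ℂ →L[ℝ] ℂ := Complex.reCLM.smulRight c₁ + Complex.imCLM.smulRight c₂
  have hAre (y : ℂ) : (A y).re = y.re * c₁.re + y.im * c₂.re := by simp [A]
  have hAim (y : ℂ) : (A y).im = y.re * c₁.im + y.im * c₂.im := by simp [A]
  have hZY : HasGaussianLaw (fun ω => (X ω - A (Y ω), Y ω)) P :=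
    hXY.map_fun ((ContinuousLinearMap.fst ℝ ℂ ℂ - A ∘L ContinuousLinearMap.snd ℝ ℂ ℂ).prod
      (ContinuousLinearMap.snd ℝ ℂ ℂ))
  refine ⟨A, hZY.fst, hZY.indepFun_of_covariance_inner fun x y => ?_⟩
  have hZre : MemLp (fun ω => (X ω - A (Y ω)).re) 2 P :=
    (hZY.fst.map_fun Complex.reCLM).memLp_two
  have hZim : MemLp (fun ω => (X ω - A (Y ω)).im) 2 P :=
    (hZY.fst.map_fun Complex.imCLM).memLp_two
  have h₁₁ : cov[fun ω => (X ω - A (Y ω)).re, fun ω => (Y ω).re; P] = 0 := by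
    simp only [Complex.sub_re, hAre]
    exact covariance_residual_re hY h hXre _
  have h₁₂ : cov[fun ω => (X ω - A (Y ω)).re, fun ω => (Y ω).im; P] = 0 := by
    simp only [Complex.sub_re, hAre]
    exact covariance_residual_im hY h hXre _
  have h₂₁ : cov[fun ω => (X ω - A (Y ω)).im, fun ω => (Y ω).re; P] = 0 := by
    simp only [Complex.sub_im, hAim]
    exact covariance_residual_re hY h hXim _
  have h₂₂ : cov[fun ω => (X ω - A (Y ω)).im, fun ω => (Y ω).im; P] = 0 := by
    simp only [Complex.sub_im, hAim]
    exact covariance_residual_im hY h hXim _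
  have hinner (u v : ℂ) : inner ℝ u v = v.re * u.re + v.im * u.im := by
    simp [Complex.inner, Complex.mul_re]
  simp only [hinner]
  rw [covariance_mul_add_mul_left hZre hZim (memLp_mul_add_mul hre him _ _),
    covariance_mul_add_mul_right hre him hZre, covariance_mul_add_mul_right hre him hZim,
    h₁₁, h₁₂, h₂₁, h₂₂]
  simp

lemma map_neg_eq_of_integral_eq_zero {Z : Ω → ℂ} (hZ : HasGaussianLaw Z P)
    (h0 : ∫ ω, Z ω ∂P = 0) : P.map (-Z) = P.map Z := by
  have := hZ.isProbabilityMeasure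
  have := hZ.isGaussian_map
  have := hZ.neg.isGaussian_map
  refine Measure.ext_of_charFun (funext fun t => ?_)
  rw [hZ.charFun_map_eq, hZ.neg.charFun_map_eq]
  simp only [Pi.neg_apply, inner_neg_right]
  rw [integral_neg, integral_inner hZ.integrable, h0, variance_fun_neg]
  simp

lemma integral_eq_zero_of_map_eq [IsProbabilityMeasure P] (hY : Measurable Y)
    (h : P.map Y = stdComplexGaussian) : ∫ ω, Y ω ∂P = 0 := by
  have hint : Integrable Y P := by
    refine Integrable.re_im_iff.1
      ⟨(memLp_re hY h).integrable one_le_two, (memLp_im hY h).integrable one_le_two⟩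
  apply Complex.ext
  · have := Complex.reCLM.integral_comp_comm hint
    simp only [Complex.reCLM_apply] at this
    rw [← this, (hasLaw_re hY h).integral_eq]
    simp
  · have := Complex.imCLM.integral_comp_comm hint
    simp only [Complex.imCLM_apply] at this
    rw [← this, (hasLaw_im hY h).integral_eq]
    simp

end StdComplexGaussian

/-- For a symmetric measure, the mean norm does not decrease when a shift is stretched. -/
lemma lintegral_norm_add_smul_le {E : Type*} [NormedAddCommGroup E] [NormedSpace ℝ E]
    [MeasurableSpace E] [BorelSpace E] {ν : Measure E}
    (hν : ν.map (fun z => -z) = ν) (w : E) {t : ℝ} (ht0 : 0 ≤ t) (ht1 : t ≤ 1) :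
    ∫⁻ z, ENNReal.ofReal ‖z + t • w‖ ∂ν ≤ ∫⁻ z, ENNReal.ofReal ‖z + w‖ ∂ν := by
  have hsub : ∫⁻ z, ENNReal.ofReal ‖z - w‖ ∂ν = ∫⁻ z, ENNReal.ofReal ‖z + w‖ ∂ν := by
    conv_rhs => rw [← hν]
    rw [lintegral_map (by fun_prop) (by fun_prop)]
    refine lintegral_congr fun z => ?_
    rw [← norm_neg]
    congr 2
    abel
  have hp : 0 ≤ (1 + t) / 2 := by linarith
  have hm : 0 ≤ (1 - t) / 2 := by linarith
  have hpt (z : E) : ENNReal.ofReal ‖z + t • w‖ ≤ ENNReal.ofReal ((1 + t) / 2) *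
      ENNReal.ofReal ‖z + w‖ + ENNReal.ofReal ((1 - t) / 2) * ENNReal.ofReal ‖z - w‖ := by
    rw [← ENNReal.ofReal_mul hp, ← ENNReal.ofReal_mul hm,
      ← ENNReal.ofReal_add (by positivity) (by positivity)]
    refine ENNReal.ofReal_le_ofReal ?_
    have : z + t • w = ((1 + t) / 2) • (z + w) + ((1 - t) / 2) • (z - w) := by module
    rw [this]
    refine (norm_add_le _ _).trans_eq ?_
    rw [norm_smul, norm_smul, Real.norm_of_nonneg hp, Real.norm_of_nonneg hm]
  calc ∫⁻ z, ENNReal.ofReal ‖z + t • w‖ ∂ν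
      ≤ ∫⁻ z, (ENNReal.ofReal ((1 + t) / 2) * ENNReal.ofReal ‖z + w‖
        + ENNReal.ofReal ((1 - t) / 2) * ENNReal.ofReal ‖z - w‖) ∂ν := lintegral_mono hpt
    _ = ∫⁻ z, ENNReal.ofReal ‖z + w‖ ∂ν := by
      rw [lintegral_add_left (by fun_prop), lintegral_const_mul _ (by fun_prop),
        lintegral_const_mul _ (by fun_prop), hsub, ← add_mul, ← ENNReal.ofReal_add hp hm]
      ring_nf
      simp

/-- Kahane's version of Slepian's lemma: if `(X, Y)` is jointly complex Gaussian (every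
real-linear functional of the pair is real Gaussian) with `X` and `Y` each standard
complex Gaussian, then `E[|X| · |Y|⁻¹] ≤ E[|X|] · E[|Y|⁻¹]`. -/
theorem stmt7 {Ω : Type*} [MeasurableSpace Ω] (P : Measure Ω) [IsProbabilityMeasure P]
    (X Y : Ω → ℂ) (hX : Measurable X) (hY : Measurable Y)
    (hXlaw : P.map X = stdComplexGaussian) (hYlaw : P.map Y = stdComplexGaussian)
    (hjoint : ∀ L : ℂ × ℂ →ₗ[ℝ] ℝ, ∃ (m : ℝ) (v : NNReal),
      P.map (fun ω => L (X ω, Y ω)) = gaussianReal m v) :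
    ∫⁻ ω, ENNReal.ofReal (‖X ω‖ * ‖Y ω‖⁻¹) ∂P
      ≤ (∫⁻ ω, ENNReal.ofReal ‖X ω‖ ∂P) * ∫⁻ ω, ENNReal.ofReal (‖Y ω‖⁻¹) ∂P := by
  have hXY : HasGaussianLaw (fun ω => (X ω, Y ω)) P := by
    refine ⟨isGaussian_of_map_eq_gaussianReal fun L => ?_⟩
    rw [Measure.map_map (by fun_prop) (by fun_prop)]
    exact hjoint L.toLinearMap
  obtain ⟨A, hZ, hindep⟩ := exists_indepFun_residual hY hYlaw hXY
  set Z : Ω → ℂ := fun ω => X ω - A (Y ω) with hZdef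
  have hZmeas : Measurable Z := by fun_prop
  have hXint : Integrable X P := hXY.fst.integrable
  have hYint : Integrable Y P := hXY.snd.integrable
  have hZ0 : ∫ ω, Z ω ∂P = 0 := by
    rw [integral_sub hXint (A.integrable_comp hYint), A.integral_comp_comm hYint,
      integral_eq_zero_of_map_eq hX hXlaw, integral_eq_zero_of_map_eq hY hYlaw, map_zero, sub_zero]
  have hsymm : (P.map Z).map (fun z => -z) = P.map Z := by
    rw [Measure.map_map (by fun_prop) hZmeas]
    exact map_neg_eq_of_integral_eq_zero hZ hZ0
  have hprob : IsProbabilityMeasure (P.map Z) := Measure.isProbabilityMeasure_map (by fun_prop)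
  have hmap : P.map (fun ω => (Y ω, Z ω)) = stdComplexGaussian.prod (P.map Z) := by
    rw [(indepFun_iff_map_prod_eq_prod_map_map (by fun_prop) (by fun_prop)).1 hindep.symm, hYlaw]
  have hXeq (ω : Ω) : X ω = Z ω + A (Y ω) := by simp [hZdef]
  set G : ℂ → ENNReal := fun y => ∫⁻ z, ENNReal.ofReal ‖z + A y‖ ∂(P.map Z) with hG
  have hGmeas : Measurable G := by
    refine Measurable.lintegral_prod_right' (f := fun p : ℂ × ℂ => ENNReal.ofReal ‖p.2 + A p.1‖) ?_
    fun_prop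
  have hdisint {F : ℂ → ENNReal} (hF : Measurable F) :
      ∫⁻ ω, ENNReal.ofReal ‖X ω‖ * F (Y ω) ∂P = ∫⁻ y, G y * F y ∂stdComplexGaussian := by
    have : ∫⁻ ω, ENNReal.ofReal ‖X ω‖ * F (Y ω) ∂P
        = ∫⁻ p : ℂ × ℂ, ENNReal.ofReal ‖p.2 + A p.1‖ * F p.1 ∂(P.map fun ω => (Y ω, Z ω)) := by
      rw [lintegral_map (by fun_prop) (by fun_prop)]
      simp only [hXeq]
    rw [this, hmap, lintegral_prod _ (by fun_prop)]
    exact lintegral_congr fun y =>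
      lintegral_mul_const (f := fun z => ENNReal.ofReal ‖z + A y‖) (F y) (by fun_prop)
  have hleft : ∫⁻ ω, ENNReal.ofReal (‖X ω‖ * ‖Y ω‖⁻¹) ∂P
      = ∫⁻ y, G y * ENNReal.ofReal (‖y‖⁻¹) ∂stdComplexGaussian := by
    rw [← hdisint (F := fun y => ENNReal.ofReal (‖y‖⁻¹)) (by fun_prop)]
    exact lintegral_congr fun ω => ENNReal.ofReal_mul (norm_nonneg _)
  have hXnorm : ∫⁻ ω, ENNReal.ofReal ‖X ω‖ ∂P = ∫⁻ y, G y ∂stdComplexGaussian := by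
    simpa using hdisint (F := fun _ => 1) measurable_const
  have hYnorm : ∫⁻ ω, ENNReal.ofReal (‖Y ω‖⁻¹) ∂P
      = ∫⁻ y, ENNReal.ofReal (‖y‖⁻¹) ∂stdComplexGaussian := by
    rw [← hYlaw, lintegral_map (by fun_prop) hY]
  rw [hleft, hXnorm, hYnorm]
  refine lintegral_radial_mul_le (F := fun r => ENNReal.ofReal r⁻¹) (by fun_prop) hGmeas ?_ ?_
  · intro r hr s _ hrs
    exact ENNReal.ofReal_le_ofReal (inv_anti₀ hr hrs)
  · intro z r s hr hrs
    have hs : 0 < s := hr.trans_le hrs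
    have : A (r * z) = (r / s) • A (s * z) := by
      rw [← map_smul, Complex.real_smul, ← mul_assoc, ← Complex.ofReal_mul,
        div_mul_cancel₀ _ hs.ne']
    simp only [hG, this]
    exact lintegral_norm_add_smul_le hsymm _ (by positivity) ((div_le_one hs).2 hrs)
end
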